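/- The even hyperbolic lattice U ⊕ D₄ ⊕ D₄ ⊕ A₁⁴ (the 2-elementary lattice with invariants (r,a,δ) = (14,8,1)) is reflective: the subgroup W_r of O(S) generated by reflections in all roots has finite index in O(S). -/

import Mathlib

open Matrix

/-- The bilinear form on `ℤⁿ` associated to a Gram matrix `G`. -/
def bform {n : ℕ} (G : Matrix (Fin n) (Fin n) ℤ) (x y : Fin n → ℤ) : ℤ :=
  x ⬝ᵥ G.mulVec y

/-- The orthogonal group `O(S)` of the lattice with Gram matrix `G`:
all `ℤ`-module automorphisms preserving the bilinear form. -/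
def OrthGroup (n : ℕ) (G : Matrix (Fin n) (Fin n) ℤ) :
    Subgroup ((Fin n → ℤ) ≃ₗ[ℤ] (Fin n → ℤ)) where
  carrier := {f | ∀ x y, bform G (f x) (f y) = bform G x y}
  one_mem' := fun _ _ => rfl
  mul_mem' := by
    intro f g hf hg x y
    exact (hf (g x) (g y)).trans (hg x y)
  inv_mem' := by
    intro f hf x y
    have h := (hf (f⁻¹ x) (f⁻¹ y)).symm
    rwa [show f (f⁻¹ x) = x from f.apply_symm_apply x,
      show f (f⁻¹ y) = y from f.apply_symm_apply y] at h

/-- A root: a vector of square `-2`, or of square `-4` whose pairing with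
the whole lattice is even. -/
def IsRoot {n : ℕ} (G : Matrix (Fin n) (Fin n) ℤ) (α : Fin n → ℤ) : Prop :=
  bform G α α = -2 ∨ (bform G α α = -4 ∧ ∀ x : Fin n → ℤ, (2 : ℤ) ∣ bform G α x)

/-- `f` is the reflection in a root `α`. -/
def IsReflection {n : ℕ} (G : Matrix (Fin n) (Fin n) ℤ)
    (f : (Fin n → ℤ) ≃ₗ[ℤ] (Fin n → ℤ)) : Prop :=
  ∃ α : Fin n → ℤ, IsRoot G α ∧
    ∀ x : Fin n → ℤ, f x = x - ((2 * bform G x α) / bform G α α) • α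

/-- The subgroup `W_r` of `O(S)` generated by the reflections in all roots. -/
def Wr (n : ℕ) (G : Matrix (Fin n) (Fin n) ℤ) : Subgroup ↥(OrthGroup n G) :=
  Subgroup.closure {f | IsReflection G f.val}

open Matrix

/-- Orthogonal direct sum of two Gram matrices. -/
def dsum {m k : ℕ} (A : Matrix (Fin m) (Fin m) ℤ) (B : Matrix (Fin k) (Fin k) ℤ) :
    Matrix (Fin (m + k)) (Fin (m + k)) ℤ :=
  Matrix.reindex finSumFinEquiv finSumFinEquiv (Matrix.fromBlocks A 0 0 B)

/-- Gram matrix of the hyperbolic plane `U`. -/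
def gramU : Matrix (Fin 2) (Fin 2) ℤ := !![0, 1; 1, 0]

/-- Gram matrix of `A₁ = ⟨-2⟩`. -/
def gramA1 : Matrix (Fin 1) (Fin 1) ℤ := !![-2]

/-- Gram matrix (= negative Cartan matrix) of a simply laced root lattice with
given Dynkin diagram edges. -/
def adjGram (n : ℕ) (E : List (ℕ × ℕ)) : Matrix (Fin n) (Fin n) ℤ :=
  Matrix.of fun i j =>
    if i = j then -2 else if (i.1, j.1) ∈ E ∨ (j.1, i.1) ∈ E then 1 else 0

/-- Gram matrix of the negative definite root lattice `Dₙ`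
(in the root basis `e₁+e₂, e₂-e₁, e₃-e₂, …, eₙ-eₙ₋₁` of `{x ∈ ℤⁿ : Σxᵢ even}`
with the negative of the standard Euclidean form). -/
def gramD (n : ℕ) : Matrix (Fin n) (Fin n) ℤ :=
  adjGram n ((0, 2) :: (List.range (n - 2)).map fun k => (k + 1, k + 2))

/-- Gram matrix (negative Cartan matrix) of `E₈`. -/
def gramE8 : Matrix (Fin 8) (Fin 8) ℤ :=
  adjGram 8 [(0, 2), (1, 3), (2, 3), (3, 4), (4, 5), (5, 6), (6, 7)]

/-- Gram matrix (negative Cartan matrix) of `E₇`. -/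
def gramE7 : Matrix (Fin 7) (Fin 7) ℤ :=
  adjGram 7 [(0, 2), (1, 3), (2, 3), (3, 4), (4, 5), (5, 6)]

/-- The Gram matrix of the even 2-elementary hyperbolic lattice `U ⊕ D₄ ⊕ D₄ ⊕ A₁⁴`,
with invariants `(r,a,δ) = (14,8,1)`. -/
def gramS :=
  dsum gramU (dsum (gramD 4) (dsum (gramD 4) (dsum gramA1 (dsum gramA1 (dsum gramA1 gramA1)))))

section BilinearForm

variable {n : ℕ} (G : Matrix (Fin n) (Fin n) ℤ)

lemma bform_add_left (x y z : Fin n → ℤ) :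
    bform G (x + y) z = bform G x z + bform G y z := by
  simp [bform, add_dotProduct]

lemma bform_smul_left (c : ℤ) (x y : Fin n → ℤ) :
    bform G (c • x) y = c * bform G x y := by
  rw [bform, smul_dotProduct, smul_eq_mul, bform]

lemma bform_smul_right (c : ℤ) (x y : Fin n → ℤ) :
    bform G x (c • y) = c * bform G x y := by
  rw [bform, mulVec_smul, dotProduct_smul, smul_eq_mul, bform]

lemma bform_neg_left (x y : Fin n → ℤ) : bform G (-x) y = -bform G x y := by
  simp [bform]

lemma bform_neg_right (x y : Fin n → ℤ) : bform G x (-y) = -bform G x y := by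
  simp [bform, mulVec_neg]

lemma bform_sub_left (x y z : Fin n → ℤ) :
    bform G (x - y) z = bform G x z - bform G y z := by
  simp [bform, sub_dotProduct]

lemma bform_sub_right (x y z : Fin n → ℤ) :
    bform G x (y - z) = bform G x y - bform G x z := by
  simp [bform, mulVec_sub, dotProduct_sub]

end BilinearForm

/-- Coordinates on an even hyperbolic lattice adapted to an isotropic vector: two functionals
`μ`, `ν` and a vector-valued functional `ω` such that `⟨x, x⟩ = 2 μ(x) ν(x) - |ω(x)|² / 2`. -/
structure LorentzFrame {n : ℕ} (G : Matrix (Fin n) (Fin n) ℤ) (k : ℕ) where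
  μ : (Fin n → ℤ) →ₗ[ℤ] ℤ
  ν : (Fin n → ℤ) →ₗ[ℤ] ℤ
  ω : (Fin n → ℤ) →ₗ[ℤ] (Fin k → ℤ)
  form : ∀ x y, 2 * bform G x y = 2 * (μ x * ν y + ν x * μ y) - ω x ⬝ᵥ ω y
  eq_zero : ∀ x, μ x = 0 → ν x = 0 → ω x = 0 → x = 0

namespace LorentzFrame

variable {n k : ℕ} {G : Matrix (Fin n) (Fin n) ℤ} (Φ : LorentzFrame G k)

lemma dotProduct_self_nonneg_int (a : Fin k → ℤ) : 0 ≤ a ⬝ᵥ a :=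
  Finset.sum_nonneg fun i _ => mul_self_nonneg (a i)

lemma bform_comm (Φ : LorentzFrame G k) (x y : Fin n → ℤ) : bform G x y = bform G y x := by
  have h1 := Φ.form x y
  have h2 := Φ.form y x
  rw [dotProduct_comm] at h2
  linarith

lemma ν_ne_zero {v : Fin n → ℤ} (hv : 0 < bform G v v) : Φ.ν v ≠ 0 := by
  intro h
  have h1 := Φ.form v v
  have h2 := dotProduct_self_nonneg_int (Φ.ω v)
  rw [h] at h1
  linarith

/-- Two vectors in the closed positive cone, one of them in the interior, pair positively. -/
lemma bform_pos {u v : Fin n → ℤ} (hu : 0 < bform G u u) (hv : 0 ≤ bform G v v)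
    (hnu : 0 < Φ.ν u) (hnv : 0 < Φ.ν v) : 0 < bform G u v := by
  have h := dotProduct_self_nonneg_int (Φ.ν u • Φ.ω v - Φ.ν v • Φ.ω u)
  simp only [sub_dotProduct, dotProduct_sub, smul_dotProduct, dotProduct_smul, smul_eq_mul,
    dotProduct_comm (Φ.ω v) (Φ.ω u)] at h
  have h1 := Φ.form u u
  have h2 := Φ.form v v
  have h3 := Φ.form u v
  have h4 : 0 < Φ.ν v ^ 2 * bform G u u := by positivity
  have h5 : 0 ≤ Φ.ν u ^ 2 * bform G v v := by positivity
  have h6 : 0 < Φ.ν u * Φ.ν v := by positivity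
  refine pos_of_mul_pos_right (a := Φ.ν u * Φ.ν v) ?_ h6.le
  have e : 4 * (Φ.ν u * Φ.ν v * bform G u v) =
      2 * (Φ.ν v ^ 2 * bform G u u) + 2 * (Φ.ν u ^ 2 * bform G v v) +
        (Φ.ν u * (Φ.ν u * Φ.ω v ⬝ᵥ Φ.ω v) - Φ.ν u * (Φ.ν v * Φ.ω u ⬝ᵥ Φ.ω v) -
        (Φ.ν v * (Φ.ν u * Φ.ω u ⬝ᵥ Φ.ω v) - Φ.ν v * (Φ.ν v * Φ.ω u ⬝ᵥ Φ.ω u))) := by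
    linear_combination 2 * Φ.ν u * Φ.ν v * h3 - Φ.ν v ^ 2 * h1 - Φ.ν u ^ 2 * h2
  linarith

/-- Only finitely many vectors have given norm and given pairing with a vector of positive
norm. -/
lemma finite_setOf_bform_eq (Φ : LorentzFrame G k) {v : Fin n → ℤ} (hv : 0 < bform G v v)
    (a c : ℤ) :
    {y : Fin n → ℤ | bform G y v = a ∧ bform G y y = c}.Finite := by
  set C : ℤ := Φ.ν v ^ 2 * (a ^ 2 - c)
  have hn0 := Φ.ν_ne_zero hv
  refine Set.Finite.of_injOn
    (f := fun y => (Φ.ν y, Φ.ν v • Φ.ω y - Φ.ν y • Φ.ω v))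
    (t := Set.Icc (a * Φ.ν v - C) (a * Φ.ν v + C) ×ˢ
      Set.Icc (fun _ => -(2 * C)) (fun _ => 2 * C)) ?_ ?_
    ((Set.finite_Icc _ _).prod (Set.finite_Icc _ _))
  · rintro y ⟨hya, hyc⟩
    set z := Φ.ν v • Φ.ω y - Φ.ν y • Φ.ω v with hz
    have key : z ⬝ᵥ z = -2 * c * Φ.ν v ^ 2 + 4 * a * Φ.ν v * Φ.ν y
        - 2 * bform G v v * Φ.ν y ^ 2 := by
      have h1 := Φ.form y y
      have h2 := Φ.form v v
      have h3 := Φ.form y v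
      rw [hya] at h3
      rw [hyc] at h1
      simp only [hz, sub_dotProduct, dotProduct_sub, smul_dotProduct, dotProduct_smul, smul_eq_mul,
        dotProduct_comm (Φ.ω v) (Φ.ω y)]
      linear_combination 2 * Φ.ν v * Φ.ν y * (-h3) + Φ.ν v ^ 2 * h1 + Φ.ν y ^ 2 * h2
    have hN : Φ.ν y ^ 2 ≤ bform G v v * Φ.ν y ^ 2 :=
      le_mul_of_one_le_left (sq_nonneg _) hv
    have hsum : z ⬝ᵥ z + 2 * (Φ.ν y - a * Φ.ν v) ^ 2 ≤ 2 * C := by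
      simp only [C]
      nlinarith
    have hz0 := dotProduct_self_nonneg_int z
    have hsq : (Φ.ν y - a * Φ.ν v) ^ 2 ≤ C := by linarith
    have hle := Int.le_self_sq (Φ.ν y - a * Φ.ν v)
    have hle' := Int.le_self_sq (-(Φ.ν y - a * Φ.ν v))
    rw [neg_sq] at hle'
    refine ⟨⟨by linarith, by linarith⟩, ?_⟩
    have hi : ∀ i, z i ^ 2 ≤ 2 * C := fun i => by
      have : z i * z i ≤ z ⬝ᵥ z :=
        Finset.single_le_sum (f := fun i => z i * z i) (fun i _ => mul_self_nonneg (z i))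
          (Finset.mem_univ i)
      nlinarith [sq_nonneg (Φ.ν y - a * Φ.ν v)]
    constructor <;> intro i
    · have := Int.le_self_sq (-z i)
      have := hi i
      rw [neg_sq] at *
      simp only
      linarith
    · exact (Int.le_self_sq _).trans (hi i)
  · rintro y ⟨hya, -⟩ y' ⟨hya', -⟩ h
    obtain ⟨h1, h2⟩ := Prod.mk.inj h
    have hω : Φ.ω y = Φ.ω y' := by
      rw [h1, sub_left_inj] at h2
      exact smul_right_injective _ hn0 h2
    have hμ : Φ.μ y = Φ.μ y' := by
      have h3 := Φ.form y v
      have h4 := Φ.form y' v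
      rw [hya] at h3
      rw [hya', ← hω, ← h1] at h4
      have h5 : (Φ.μ y - Φ.μ y') * Φ.ν v = 0 := by linarith
      rcases mul_eq_zero.mp h5 with h5 | h5
      · exact sub_eq_zero.mp h5
      · exact absurd h5 hn0
    exact sub_eq_zero.mp (Φ.eq_zero _ (by simp [hμ]) (by simp [h1]) (by simp [hω]))

variable {ι : Type*} {r : ι → Fin n → ℤ}

/-- If the chamber cut out by finitely many vectors lies in the positive cone, then it contains
only finitely many vectors of each positive norm. -/
lemma finite_chamber [Finite ι]
    (hr : ∀ x, (∀ i, 0 ≤ bform G x (r i)) → 0 ≤ bform G x x) {N : ℤ} (hN : 0 < N) :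
    {v | 0 < Φ.ν v ∧ bform G v v = N ∧ ∀ i, 0 ≤ bform G v (r i)}.Finite := by
  by_contra hinf
  have hinf : Set.Infinite _ := hinf
  set f := hinf.natEmbedding
  have hwqo := wellQuasiOrdered_le (α := ι → ℕ)
    (fun k i => (bform G (f k).1 (r i)).toNat)
  obtain ⟨i, j, hij, hle⟩ := hwqo
  obtain ⟨hv1, hv2, hv3⟩ := (f i).2
  obtain ⟨hu1, hu2, hu3⟩ := (f j).2
  have hne : (f i).1 ≠ (f j).1 := fun h =>
    hij.ne (f.injective (Subtype.ext h))
  set v : Fin n → ℤ := (f i).1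
  set u : Fin n → ℤ := (f j).1
  have hw : 0 ≤ bform G (u - v) (u - v) := hr _ fun l => by
    have h1 := hle l
    have h2 := hv3 l
    have h3 := hu3 l
    simp only at h1
    rw [bform_sub_left]
    omega
  have hcomm := Φ.bform_comm u v
  rcases lt_trichotomy (Φ.ν (u - v)) 0 with h | h | h
  · have := Φ.bform_pos (u := u) (v := v - u) (by omega)
      (by rw [← neg_sub, bform_neg_left, bform_neg_right, neg_neg]; exact hw) hu1
      (by rw [← neg_sub, map_neg]; omega)
    simp only [bform_sub_left, bform_sub_right] at hw this
    omega
  · have hform := Φ.form (u - v) (u - v)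
    have hsq := dotProduct_self_nonneg_int (Φ.ω (u - v))
    rw [h] at hform
    have hω : Φ.ω (u - v) = 0 := dotProduct_self_eq_zero.mp (by linarith)
    have hform' := Φ.form (u - v) v
    rw [h, hω, zero_dotProduct] at hform'
    have hb : bform G (u - v) v = 0 := by
      have : bform G (u - v) (u - v) = 0 := by rw [hω, zero_dotProduct] at hform; linarith
      simp only [bform_sub_left, bform_sub_right] at this ⊢
      omega
    have hμ : Φ.μ (u - v) = 0 := by
      have : Φ.μ (u - v) * Φ.ν v = 0 := by linarith
      exact (mul_eq_zero.mp this).resolve_right hv1.ne'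
    exact hne (sub_eq_zero.mp (Φ.eq_zero _ hμ h hω)).symm
  · have := Φ.bform_pos (u := v) (v := u - v) (by omega) hw hv1 h
    simp only [bform_sub_left, bform_sub_right] at hw this
    omega

end LorentzFrame

section Reflection

variable {n k : ℕ} {G : Matrix (Fin n) (Fin n) ℤ}

lemma IsRoot.norm_neg {α : Fin n → ℤ} (hα : IsRoot G α) : bform G α α < 0 := by
  rcases hα with h | ⟨h, -⟩ <;> omega

lemma IsRoot.norm_dvd (Φ : LorentzFrame G k) {α : Fin n → ℤ} (hα : IsRoot G α) (x : Fin n → ℤ) :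
    bform G α α ∣ 2 * bform G x α := by
  rw [Φ.bform_comm x]
  rcases hα with h | ⟨h, h2⟩
  · rw [h, Int.neg_dvd]
    exact dvd_mul_right _ _
  · rw [h, Int.neg_dvd]
    exact mul_dvd_mul_left 2 (h2 x)

/-- The reflection in a root belongs to `W_r`. -/
lemma IsRoot.exists_mem_Wr (Φ : LorentzFrame G k) {α : Fin n → ℤ} (hα : IsRoot G α) :
    ∃ s ∈ Wr n G, ∀ x, ∃ c : ℤ, c * bform G α α = 2 * bform G x α ∧ s.1 x = x - c • α := by
  have hdvd := hα.norm_dvd Φ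
  have h0 := hα.norm_neg.ne
  let φ : Module.Dual ℤ (Fin n → ℤ) :=
    { toFun := fun x => 2 * bform G x α / bform G α α
      map_add' := fun x y => by
        rw [bform_add_left, mul_add, Int.add_ediv_of_dvd_left (hdvd x)]
      map_smul' := fun c x => by
        rw [bform_smul_left, mul_left_comm, Int.mul_ediv_assoc _ (hdvd x)]
        rfl }
  have hφ : ∀ x, φ x * bform G α α = 2 * bform G x α := fun x =>
    Int.ediv_mul_cancel (hdvd x)
  have hα2 : φ α = 2 := mul_right_cancel₀ h0 (hφ α)
  let s := Module.reflection hα2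
  have hs : ∀ x, s x = x - φ x • α := fun x => Module.reflection_apply _ _
  refine ⟨⟨s, fun x y => ?_⟩, Subgroup.subset_closure ⟨α, hα, hs⟩, fun x => ⟨φ x, hφ x, hs x⟩⟩
  have hx := hφ x
  have hy := hφ y
  rw [hs, hs]
  simp only [bform_sub_left, bform_sub_right, bform_smul_left, bform_smul_right,
    Φ.bform_comm α y]
  refine mul_left_cancel₀ (two_ne_zero (α := ℤ)) ?_
  linear_combination φ y * hx + φ x * hy

end Reflection

namespace LorentzFrame

variable {n k : ℕ} {G : Matrix (Fin n) (Fin n) ℤ} (Φ : LorentzFrame G k)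
  {ι : Type*} {r : ι → Fin n → ℤ}

/-- Every vector of positive norm in the positive cone can be moved into the chamber. -/
lemma exists_mem_Wr_chamber (hroot : ∀ i, IsRoot G (r i)) {ρ : Fin n → ℤ}
    (hρ : 0 < bform G ρ ρ) (hνρ : 0 < Φ.ν ρ) (hρr : ∀ i, 0 < bform G ρ (r i))
    {x : Fin n → ℤ} (hx : 0 < bform G x x) (hνx : 0 < Φ.ν x) :
    ∃ g ∈ Wr n G, 0 < Φ.ν (g.1 x) ∧ ∀ i, 0 ≤ bform G (g.1 x) (r i) := by
  induction h : (bform G ρ x).toNat using Nat.strong_induction_on generalizing x with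
  | _ m ih =>
    by_cases hpos : ∀ i, 0 ≤ bform G x (r i)
    · exact ⟨1, one_mem _, hνx, hpos⟩
    push Not at hpos
    obtain ⟨i, hi⟩ := hpos
    obtain ⟨s, hs, hsx⟩ := (hroot i).exists_mem_Wr Φ
    obtain ⟨c, hc, hcx⟩ := hsx x
    have hneg := (hroot i).norm_neg
    have hc0 : 0 < c := by nlinarith
    have hnorm : bform G (s.1 x) (s.1 x) = bform G x x := s.2 x x
    have hxs : 0 < bform G x (s.1 x) := by
      rw [hcx, bform_sub_right, bform_smul_right]
      nlinarith
    have hνs : 0 < Φ.ν (s.1 x) := by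
      rcases lt_trichotomy (Φ.ν (s.1 x)) 0 with h0 | h0 | h0
      · have := Φ.bform_pos (u := x) (v := -s.1 x) hx
          (by rw [bform_neg_left, bform_neg_right, neg_neg, hnorm]; exact hx.le) hνx
          (by rw [map_neg]; omega)
        rw [bform_neg_right] at this
        omega
      · exact absurd h0 (Φ.ν_ne_zero (hnorm ▸ hx))
      · exact h0
    have hlt : bform G ρ (s.1 x) < bform G ρ x := by
      rw [hcx, bform_sub_right, bform_smul_right]
      nlinarith [hρr i]
    have hρs := Φ.bform_pos hρ (hnorm ▸ hx.le) hνρ hνs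
    obtain ⟨g, hg, h1, h2⟩ := ih _ (by omega) (hnorm ▸ hx) hνs rfl
    exact ⟨g * s, mul_mem hg hs, h1, h2⟩

/-- Vinberg's criterion: if finitely many roots bound a chamber which has an interior point and
lies in the positive cone, then the reflections generate a subgroup of finite index. -/
theorem finiteIndex_Wr [Finite ι] (hroot : ∀ i, IsRoot G (r i)) {ρ : Fin n → ℤ}
    (hρ : 0 < bform G ρ ρ) (hνρ : 0 < Φ.ν ρ) (hρr : ∀ i, 0 < bform G ρ (r i))
    (hr : ∀ x, (∀ i, 0 ≤ bform G x (r i)) → 0 ≤ bform G x x) : (Wr n G).FiniteIndex := by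
  set F := {v | 0 < Φ.ν v ∧ bform G v v = bform G ρ ρ ∧ ∀ i, 0 ≤ bform G v (r i)}
  have hF : F.Finite := Φ.finite_chamber hr hρ
  set T : Set (OrthGroup n G) := {t | t.1 ρ ∈ F ∪ -F}
  have hT : T.Finite := by
    have hsub : T ⊆ ⋃ v ∈ F ∪ -F, {t | t.1 ρ = v} := fun t ht => by
      exact Set.mem_biUnion ht rfl
    refine Set.Finite.subset ((hF.union hF.neg).biUnion fun v hv => ?_) hsub
    have hv0 : 0 < bform G v v := by
      rcases hv with hv | hv
      · exact hv.2.1 ▸ hρ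
      · have := hv.2.1
        rw [bform_neg_left, bform_neg_right, neg_neg] at this
        exact this ▸ hρ
    refine Set.Finite.of_injOn (f := fun t (j : Fin n) => t.1 (Pi.single j 1))
      (t := Set.pi Set.univ fun j => {y | bform G y v = bform G (Pi.single j 1) ρ ∧
        bform G y y = bform G (Pi.single j 1) (Pi.single j 1)}) ?_ ?_
      (Set.Finite.pi fun j => Φ.finite_setOf_bform_eq hv0 _ _)
    · rintro t rfl j -
      exact ⟨t.2 _ _, t.2 _ _⟩
    · intro t _ t' _ h
      refine Subtype.ext (LinearEquiv.toLinearMap_injective (LinearMap.pi_ext' fun j => ?_))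
      ext1
      exact congrFun h j
  have : Finite T := hT
  have hsurj : Function.Surjective
      fun t : T => (QuotientGroup.mk (t : OrthGroup n G)⁻¹ : OrthGroup n G ⧸ Wr n G) := by
    intro q
    obtain ⟨g, rfl⟩ := QuotientGroup.mk_surjective q
    have hnorm : bform G (g⁻¹.1 ρ) (g⁻¹.1 ρ) = bform G ρ ρ := g⁻¹.2 ρ ρ
    have hex : ∃ w ∈ Wr n G, (w * g⁻¹).1 ρ ∈ F ∪ -F := by
      rcases (Φ.ν_ne_zero (hnorm ▸ hρ)).lt_or_gt with h | h
      · have hnorm' : bform G (-g⁻¹.1 ρ) (-g⁻¹.1 ρ) = bform G ρ ρ := by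
          rw [bform_neg_left, bform_neg_right, neg_neg, hnorm]
        obtain ⟨w, hw, h1, h2⟩ := Φ.exists_mem_Wr_chamber hroot hρ hνρ hρr (hnorm' ▸ hρ)
          (by rw [map_neg]; omega)
        have hneg : w.1 (-g⁻¹.1 ρ) = -(w * g⁻¹).1 ρ := map_neg w.1 _
        exact ⟨w, hw, Or.inr ⟨hneg ▸ h1, hneg ▸ (w.2 _ _).trans hnorm', hneg ▸ h2⟩⟩
      · obtain ⟨w, hw, h1, h2⟩ := Φ.exists_mem_Wr_chamber hroot hρ hνρ hρr (hnorm ▸ hρ) h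
        exact ⟨w, hw, Or.inl ⟨h1, (w.2 _ _).trans hnorm, h2⟩⟩
    obtain ⟨w, hw, hmem⟩ := hex
    refine ⟨⟨w * g⁻¹, hmem⟩, QuotientGroup.eq.mpr ?_⟩
    simpa using hw
  have := Finite.of_surjective _ hsurj
  exact Subgroup.finiteIndex_of_finite_quotient

end LorentzFrame
/-- The quadratic form is nonnegative on a fundamental domain for the symmetries of the chamber. -/
lemma sum_sq_le_of_sorted {M n a1 a2 a3 a4 b1 b2 b3 b4 c1 c2 c3 c4 : ℤ}
    (ha0 : 0 ≤ n - a1) (ha1 : 0 ≤ a1 - a2) (ha2 : 0 ≤ a2 - a3)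
    (ha3 : 0 ≤ a3 - a4) (ha4 : 0 ≤ a4)
    (hb0 : 0 ≤ n - b1) (hb1 : 0 ≤ b1 - b2) (hb2 : 0 ≤ b2 - b3)
    (hb3 : 0 ≤ b3 - b4) (hb4 : 0 ≤ b4)
    (hc0 : 0 ≤ n - c1) (hc1 : 0 ≤ c1 - c2) (hc2 : 0 ≤ c2 - c3)
    (hc3 : 0 ≤ c3 - c4) (hc4 : 0 ≤ c4)
    (hm : 0 ≤ M - 2 * n)
    (hd : 0 ≤ M + 2 * n - (a1 + a2) - (b1 + b2) - (c1 + c2))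
    (ho : 0 ≤ M + 2 * n - (a1 + a2 + a3) - b1 - c1)
    (hab : 0 ≤ (a1 + a2 + a3 + a4) - (b1 + b2 + b3 + b4))
    (hbc : 0 ≤ (b1 + b2 + b3 + b4) - (c1 + c2 + c3 + c4))
    (hs : 0 ≤ 4 * n - (a1 + a2 + a3 + a4) - (b1 + b2 + b3 + b4)) :
    a1 ^ 2 + a2 ^ 2 + a3 ^ 2 + a4 ^ 2 + (b1 ^ 2 + b2 ^ 2 + b3 ^ 2 + b4 ^ 2) +
      (c1 ^ 2 + c2 ^ 2 + c3 ^ 2 + c4 ^ 2) ≤ 2 * M * n := by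
  rcases le_total 0 (b1 + b2 + b3 - a1 - a2) with p1 | q1
  · refine le_of_mul_le_mul_left (a := 2) ?_ (by norm_num)
    linear_combination
      2 * mul_nonneg ha0 ha1 + 4 * mul_nonneg ha0 ha2 + 2 * mul_nonneg ha0 hd +
      2 * mul_nonneg ha1 ha2 + 2 * mul_nonneg ha1 hd + 2 * mul_nonneg ha2 hd +
      2 * mul_nonneg ha3 ha4 + mul_nonneg ha3 hd + mul_nonneg ha3 hs + mul_nonneg ha4 hs +
      2 * mul_nonneg hb0 hb1 + 2 * mul_nonneg hb0 hm + 2 * mul_nonneg hb1 hm +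
      2 * mul_nonneg hb2 hb3 + 4 * mul_nonneg hb2 hb4 + 2 * mul_nonneg hb2 hm +
      mul_nonneg hb2 hs + 2 * mul_nonneg hb3 hb4 + 2 * mul_nonneg hb3 hm + mul_nonneg hb3 hs +
      mul_nonneg hb4 hd + mul_nonneg hb4 hs + 2 * mul_nonneg hc0 hc1 + 2 * mul_nonneg hc2 hbc +
      2 * mul_nonneg hc2 hc3 + 4 * mul_nonneg hc2 hc4 + mul_nonneg hc2 hs +
      2 * mul_nonneg hc3 hbc + 2 * mul_nonneg hc3 hc4 + mul_nonneg hc3 hs +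
      2 * mul_nonneg hc4 hbc + mul_nonneg hc4 hs + mul_nonneg hd p1 + 2 * mul_nonneg hm hb4 +
      mul_nonneg ho hab
  rw [← neg_nonneg] at q1
  rcases le_total 0 (b1 + c1 + c2 + c3 + c4 - 2 * n) with p2 | q2
  · refine le_of_mul_le_mul_left (a := 2) ?_ (by norm_num)
    linear_combination
      2 * mul_nonneg ha0 ha1 + 4 * mul_nonneg ha0 ha2 + 2 * mul_nonneg ha0 hm +
      2 * mul_nonneg ha1 ha2 + 2 * mul_nonneg ha1 hm + 2 * mul_nonneg ha2 hm +
      2 * mul_nonneg ha3 ha4 + 2 * mul_nonneg ha3 hm + 2 * mul_nonneg ha3 hs +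
      2 * mul_nonneg ha4 hm + 2 * mul_nonneg ha4 hs + 2 * mul_nonneg hb0 hb1 +
      2 * mul_nonneg hb0 hd + 2 * mul_nonneg hb2 hb3 + 4 * mul_nonneg hb2 hb4 +
      2 * mul_nonneg hb3 hb4 + 2 * mul_nonneg hc0 hc1 + 2 * mul_nonneg hc2 hbc +
      2 * mul_nonneg hc2 hc3 + 4 * mul_nonneg hc2 hc4 + 2 * mul_nonneg hc3 hbc +
      2 * mul_nonneg hc3 hc4 + 2 * mul_nonneg hc4 hbc + 2 * mul_nonneg hd hbc +
      2 * mul_nonneg hd p2 + mul_nonneg ho hab + mul_nonneg ho hs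
  rw [← neg_nonneg] at q2
  rcases le_total 0 (b1 + b2 + b3 + b4 + c1 - 2 * n) with p3 | q3
  · refine le_of_mul_le_mul_left (a := 2) ?_ (by norm_num)
    linear_combination
      2 * mul_nonneg ha0 ha1 + 4 * mul_nonneg ha0 ha2 + 2 * mul_nonneg ha1 ha2 +
      2 * mul_nonneg ha3 ha4 + 2 * mul_nonneg ha3 hs + 2 * mul_nonneg ha4 hs +
      2 * mul_nonneg hb0 hb1 + 2 * mul_nonneg hb2 hb3 + 4 * mul_nonneg hb2 hb4 +
      2 * mul_nonneg hb3 hb4 + 2 * mul_nonneg hc0 hc1 + 2 * mul_nonneg hc0 hd +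
      2 * mul_nonneg hc0 hm + 2 * mul_nonneg hc2 hbc + 2 * mul_nonneg hc2 hc3 +
      4 * mul_nonneg hc2 hc4 + 2 * mul_nonneg hc3 hbc + 2 * mul_nonneg hc3 hc4 +
      2 * mul_nonneg hc4 hbc + 2 * mul_nonneg hd p3 + mul_nonneg hm hab + mul_nonneg hm hs +
      2 * mul_nonneg hm p3 + mul_nonneg ho hab + mul_nonneg ho hs
  rw [← neg_nonneg] at q3
  rcases le_total 0 (b1 - a3) with p4 | q4
  · refine le_of_mul_le_mul_left (a := 4) ?_ (by norm_num)
    linear_combination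
      4 * mul_nonneg ha0 ha1 + 8 * mul_nonneg ha0 ha2 + 4 * mul_nonneg ha0 hb3 +
      4 * mul_nonneg ha0 hb4 + 4 * mul_nonneg ha1 ha2 + 2 * mul_nonneg ha1 hb3 +
      2 * mul_nonneg ha1 hb4 + 4 * mul_nonneg ha3 ha4 + 2 * mul_nonneg ha3 hb3 +
      4 * mul_nonneg ha3 hb4 + 4 * mul_nonneg ha3 hs + 2 * mul_nonneg ha4 hb3 +
      4 * mul_nonneg ha4 hb4 + 4 * mul_nonneg ha4 hs + 4 * mul_nonneg hb0 hm +
      4 * mul_nonneg hb0 p4 + 4 * mul_nonneg hb1 hm + 2 * mul_nonneg hb1 ho +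
      2 * mul_nonneg hb2 hb3 + 4 * mul_nonneg hb2 hb4 + 2 * mul_nonneg hb2 hc2 +
      2 * mul_nonneg hb2 hc3 + 2 * mul_nonneg hb2 hc4 + 4 * mul_nonneg hb2 hd +
      4 * mul_nonneg hb2 hm + 4 * mul_nonneg hb3 hb4 + 4 * mul_nonneg hb3 hd +
      6 * mul_nonneg hb3 hm + 2 * mul_nonneg hb3 q3 + 6 * mul_nonneg hb4 hd +
      2 * mul_nonneg hb4 q3 + 2 * mul_nonneg hc1 hbc + 2 * mul_nonneg hc1 hc2 +
      4 * mul_nonneg hc1 hc3 + 6 * mul_nonneg hc1 hc4 + 2 * mul_nonneg hc1 q3 +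
      2 * mul_nonneg hc2 hbc + 4 * mul_nonneg hc2 hc3 + 8 * mul_nonneg hc2 hc4 +
      2 * mul_nonneg hc2 q2 + 2 * mul_nonneg hc3 hbc + 4 * mul_nonneg hc3 hc4 +
      2 * mul_nonneg hc3 q2 + 2 * mul_nonneg hc4 hbc + 2 * mul_nonneg hc4 q2 +
      6 * mul_nonneg hm hb4 + mul_nonneg ho hab + mul_nonneg ho hs
  rw [← neg_nonneg] at q4
  rcases le_total 0 (3 * a4 - n) with p5 | q5
  · refine le_of_mul_le_mul_left (a := 30) ?_ (by norm_num)
    linear_combination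
      30 * mul_nonneg ha0 ha1 + 60 * mul_nonneg ha0 ha2 + 60 * mul_nonneg ha0 q3 +
      30 * mul_nonneg ha1 ha2 + 45 * mul_nonneg ha1 q3 + 30 * mul_nonneg ha2 q3 +
      5 * mul_nonneg ha3 hbc + 10 * mul_nonneg ha3 hc1 + 5 * mul_nonneg ha3 hc3 +
      10 * mul_nonneg ha3 hc4 + 33 * mul_nonneg ha3 hs + 10 * mul_nonneg ha3 p5 +
      5 * mul_nonneg ha3 q3 + 30 * mul_nonneg hb1 hb2 + 60 * mul_nonneg hb1 hb3 +
      90 * mul_nonneg hb1 hb4 + 15 * mul_nonneg hb1 ho + 6 * mul_nonneg hb1 hs +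
      30 * mul_nonneg hb2 hb3 + 60 * mul_nonneg hb2 hb4 + 30 * mul_nonneg hb2 ho +
      12 * mul_nonneg hb2 hs + 30 * mul_nonneg hb3 hb4 + 45 * mul_nonneg hb3 ho +
      18 * mul_nonneg hb3 hs + 60 * mul_nonneg hb4 ho + 21 * mul_nonneg hb4 hs +
      15 * mul_nonneg hbc q4 + 15 * mul_nonneg hc1 hbc + 15 * mul_nonneg hc1 hc2 +
      30 * mul_nonneg hc1 hc3 + 45 * mul_nonneg hc1 hc4 + 30 * mul_nonneg hc1 hm +
      15 * mul_nonneg hc1 ho + 30 * mul_nonneg hc2 hbc + 30 * mul_nonneg hc2 hc3 +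
      60 * mul_nonneg hc2 hc4 + 60 * mul_nonneg hc2 hm + 15 * mul_nonneg hc2 hs +
      30 * mul_nonneg hc2 q4 + 30 * mul_nonneg hc3 hbc + 30 * mul_nonneg hc3 hc4 +
      75 * mul_nonneg hc3 hm + 15 * mul_nonneg hc3 hs + 45 * mul_nonneg hc3 q4 +
      30 * mul_nonneg hc4 hbc + 15 * mul_nonneg hc4 hs + 60 * mul_nonneg hc4 q4 +
      15 * mul_nonneg hm hbc + 90 * mul_nonneg hm hc4 + 30 * mul_nonneg hm q3 +
      3 * mul_nonneg hs hs + 12 * mul_nonneg hs p5 + 3 * mul_nonneg hs q1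
  rw [← neg_nonneg] at q5
  refine le_of_mul_le_mul_left (a := 6) ?_ (by norm_num)
  linear_combination
    6 * mul_nonneg ha0 ha1 + 12 * mul_nonneg ha0 ha2 + 2 * mul_nonneg ha0 ha4 +
    12 * mul_nonneg ha0 q3 + 6 * mul_nonneg ha1 ha2 + mul_nonneg ha1 ha4 +
    9 * mul_nonneg ha1 q3 + 6 * mul_nonneg ha2 q3 + mul_nonneg ha3 ha4 + 3 * mul_nonneg ha3 ho +
    3 * mul_nonneg ha3 hs + 2 * mul_nonneg ha4 hb2 + mul_nonneg ha4 hb3 +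
    3 * mul_nonneg ha4 hc2 + 3 * mul_nonneg ha4 hc3 + 3 * mul_nonneg ha4 hc4 +
    3 * mul_nonneg ha4 hm + 3 * mul_nonneg ha4 ho + 2 * mul_nonneg ha4 hs + mul_nonneg ha4 q4 +
    2 * mul_nonneg ha4 q5 + 3 * mul_nonneg hb1 hb3 + 6 * mul_nonneg hb1 hb4 +
    3 * mul_nonneg hb1 hc1 + 3 * mul_nonneg hb1 ho + 3 * mul_nonneg hb1 q4 +
    6 * mul_nonneg hb2 hb3 + 12 * mul_nonneg hb2 hb4 + 3 * mul_nonneg hb2 hd +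
    3 * mul_nonneg hb2 hm + 3 * mul_nonneg hb2 hs + 6 * mul_nonneg hb3 hb4 +
    3 * mul_nonneg hb3 hd + 3 * mul_nonneg hb3 hm + 3 * mul_nonneg hb3 ho +
    3 * mul_nonneg hb3 hs + 3 * mul_nonneg hb4 hd + 6 * mul_nonneg hb4 ho +
    3 * mul_nonneg hb4 hs + 3 * mul_nonneg hc1 hbc + 3 * mul_nonneg hc1 hc2 +
    6 * mul_nonneg hc1 hc3 + 9 * mul_nonneg hc1 hc4 + 3 * mul_nonneg hc1 ho +
    6 * mul_nonneg hc2 hbc + 6 * mul_nonneg hc2 hc3 + 12 * mul_nonneg hc2 hc4 +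
    6 * mul_nonneg hc2 hm + 3 * mul_nonneg hc2 hs + 6 * mul_nonneg hc3 hbc +
    6 * mul_nonneg hc3 hc4 + 9 * mul_nonneg hc3 hm + 3 * mul_nonneg hc3 hs +
    6 * mul_nonneg hc4 hbc + 3 * mul_nonneg hc4 hs + 3 * mul_nonneg hm hbc +
    12 * mul_nonneg hm hc4 + 3 * mul_nonneg hm hs + 3 * mul_nonneg hm q1
/-- The inequalities `n ≥ a₀ ≥ a₁ ≥ a₂ ≥ a₃ ≥ 0`. -/
structure IsBlock (n : ℤ) (a : Fin 4 → ℤ) : Prop where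
  le_top : a 0 ≤ n
  le_zero : a 1 ≤ a 0
  le_one : a 2 ≤ a 1
  le_two : a 3 ≤ a 2
  nonneg : 0 ≤ a 3

/-- The inequalities cutting out the fundamental chamber of `U ⊕ D₄ ⊕ D₄ ⊕ A₁⁴`, in the
coordinates `M = 2μ`, `n = ν` and `ω = (a, b, c)`. -/
structure IsChamber (M n : ℤ) (a b c : Fin 4 → ℤ) : Prop where
  fst : IsBlock n a
  snd : IsBlock n b
  trd : IsBlock n c
  two_le : 2 * n ≤ M
  sum_fst_snd : (a 0 + a 1 + a 2 + a 3) + (b 0 + b 1 + b 2 + b 3) ≤ M + 2 * n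
  sum_fst_trd : (a 0 + a 1 + a 2 + a 3) + (c 0 + c 1 + c 2 + c 3) ≤ M + 2 * n
  sum_snd_trd : (b 0 + b 1 + b 2 + b 3) + (c 0 + c 1 + c 2 + c 3) ≤ M + 2 * n
  sum_two : (a 0 + a 1) + (b 0 + b 1) + (c 0 + c 1) ≤ M + 2 * n
  sum_three : (a 0 + a 1 + a 2) + (b 0 + b 1 + b 2) + (c 0 + c 1 + c 2) ≤ M + 4 * n
  three_fst : (a 0 + a 1 + a 2) + b 0 + c 0 ≤ M + 2 * n
  three_snd : a 0 + (b 0 + b 1 + b 2) + c 0 ≤ M + 2 * n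
  three_trd : a 0 + b 0 + (c 0 + c 1 + c 2) ≤ M + 2 * n

/-- The inequality saying that a vector has nonnegative norm. -/
def NormNonneg (M n : ℤ) (a b c : Fin 4 → ℤ) : Prop :=
  a 0 ^ 2 + a 1 ^ 2 + a 2 ^ 2 + a 3 ^ 2 + (b 0 ^ 2 + b 1 ^ 2 + b 2 ^ 2 + b 3 ^ 2) +
    (c 0 ^ 2 + c 1 ^ 2 + c 2 ^ 2 + c 3 ^ 2) ≤ 2 * M * n

namespace IsChamber

variable {M n : ℤ} {a b c : Fin 4 → ℤ}

lemma swap_fst_snd (h : IsChamber M n a b c) : IsChamber M n b a c := by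
  obtain ⟨h1, h2, h3, _, _, _, _, _, _, _, _, _⟩ := h
  constructor <;> first | assumption | linarith

lemma swap_snd_trd (h : IsChamber M n a b c) : IsChamber M n a c b := by
  obtain ⟨h1, h2, h3, _, _, _, _, _, _, _, _, _⟩ := h
  constructor <;> first | assumption | linarith

/-- To prove a symmetric statement on the chamber one may assume that the blocks are sorted by
their sums. -/
lemma sorted_induction {P : (Fin 4 → ℤ) → (Fin 4 → ℤ) → (Fin 4 → ℤ) → Prop}
    (h₁ : ∀ a b c, P a b c → P b a c) (h₂ : ∀ a b c, P a b c → P a c b)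
    (hP : ∀ a b c, IsChamber M n a b c →
      b 0 + b 1 + b 2 + b 3 ≤ a 0 + a 1 + a 2 + a 3 →
      c 0 + c 1 + c 2 + c 3 ≤ b 0 + b 1 + b 2 + b 3 → P a b c)
    (h : IsChamber M n a b c) : P a b c := by
  rcases le_total (b 0 + b 1 + b 2 + b 3) (a 0 + a 1 + a 2 + a 3) with hab | hab <;>
  rcases le_total (c 0 + c 1 + c 2 + c 3) (b 0 + b 1 + b 2 + b 3) with hbc | hbc <;>
  rcases le_total (c 0 + c 1 + c 2 + c 3) (a 0 + a 1 + a 2 + a 3) with hac | hac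
  · exact hP _ _ _ h hab hbc
  · exact hP _ _ _ h hab hbc
  · exact h₂ _ _ _ (hP _ _ _ h.swap_snd_trd hac hbc)
  · exact h₂ _ _ _ (h₁ _ _ _ (hP _ _ _ h.swap_snd_trd.swap_fst_snd hac hab))
  · exact h₁ _ _ _ (hP _ _ _ h.swap_fst_snd hab hac)
  · exact h₁ _ _ _ (h₂ _ _ _ (hP _ _ _ h.swap_fst_snd.swap_snd_trd hbc hac))
  · exact h₁ _ _ _ (h₂ _ _ _ (h₁ _ _ _
      (hP _ _ _ h.swap_fst_snd.swap_snd_trd.swap_fst_snd hbc hab)))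
  · exact h₁ _ _ _ (h₂ _ _ _ (h₁ _ _ _
      (hP _ _ _ h.swap_fst_snd.swap_snd_trd.swap_fst_snd hbc hab)))

end IsChamber

namespace NormNonneg

variable {M n : ℤ} {a b c : Fin 4 → ℤ}

lemma swap_fst_snd (h : NormNonneg M n a b c) : NormNonneg M n b a c := by
  unfold NormNonneg at *; linarith

lemma swap_snd_trd (h : NormNonneg M n a b c) : NormNonneg M n a c b := by
  unfold NormNonneg at *; linarith

end NormNonneg

/-- The reversed block `n - a₃, n - a₂, n - a₁, n - a₀`. -/
def flipBlock (n : ℤ) (a : Fin 4 → ℤ) : Fin 4 → ℤ := ![n - a 3, n - a 2, n - a 1, n - a 0]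

section flipBlock

variable (n : ℤ) (a : Fin 4 → ℤ)

@[simp] lemma flipBlock_zero : flipBlock n a 0 = n - a 3 := rfl

@[simp] lemma flipBlock_one : flipBlock n a 1 = n - a 2 := rfl

@[simp] lemma flipBlock_two : flipBlock n a 2 = n - a 1 := rfl

@[simp] lemma flipBlock_three : flipBlock n a 3 = n - a 0 := rfl

end flipBlock

namespace IsChamber

variable {M n : ℤ} {a b c : Fin 4 → ℤ}

lemma flip (h : IsChamber M n a b c) :
    IsChamber (M + 4 * n - (a 0 + a 1 + a 2 + a 3) - (b 0 + b 1 + b 2 + b 3)) n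
      (flipBlock n a) (flipBlock n b) c := by
  obtain ⟨⟨_, _, _, _, _⟩, ⟨_, _, _, _, _⟩, h3, _, _, _, _, _, _, _, _, _⟩ := h
  constructor <;> first
    | exact h3
    | linarith
    | (constructor <;> simp only [flipBlock_zero, flipBlock_one, flipBlock_two,
        flipBlock_three] <;> linarith)
    | (simp only [flipBlock_zero, flipBlock_one, flipBlock_two, flipBlock_three]; linarith)

lemma normNonneg_of_sum_le (h : IsChamber M n a b c)
    (hab : (a 0 + a 1 + a 2 + a 3) + (b 0 + b 1 + b 2 + b 3) ≤ 4 * n)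
    (hac : (a 0 + a 1 + a 2 + a 3) + (c 0 + c 1 + c 2 + c 3) ≤ 4 * n)
    (hbc : (b 0 + b 1 + b 2 + b 3) + (c 0 + c 1 + c 2 + c 3) ≤ 4 * n) :
    NormNonneg M n a b c := by
  revert hab hac hbc
  refine sorted_induction (P := fun a b c =>
      (a 0 + a 1 + a 2 + a 3) + (b 0 + b 1 + b 2 + b 3) ≤ 4 * n →
      (a 0 + a 1 + a 2 + a 3) + (c 0 + c 1 + c 2 + c 3) ≤ 4 * n →
      (b 0 + b 1 + b 2 + b 3) + (c 0 + c 1 + c 2 + c 3) ≤ 4 * n → NormNonneg M n a b c)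
    (fun a b c H h1 h2 h3 => (H (by linarith) h3 h2).swap_fst_snd)
    (fun a b c H h1 h2 h3 => (H h2 h1 (by linarith)).swap_snd_trd)
    (fun a b c h hab hbc hs _ _ => ?_) h
  obtain ⟨⟨_, _, _, _, _⟩, ⟨_, _, _, _, _⟩, ⟨_, _, _, _, _⟩, _, _, _, _, _, _, _, _, _⟩ := h
  apply sum_sq_le_of_sorted <;> linarith

lemma normNonneg (h : IsChamber M n a b c) : NormNonneg M n a b c := by
  refine sorted_induction (fun a b c => NormNonneg.swap_fst_snd)
    (fun a b c => NormNonneg.swap_snd_trd) (fun a b c h hab hbc => ?_) h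
  rcases le_total ((a 0 + a 1 + a 2 + a 3) + (b 0 + b 1 + b 2 + b 3)) (4 * n) with hs | hs
  · exact h.normNonneg_of_sum_le hs (by linarith) (by linarith)
  · have := h.flip.normNonneg_of_sum_le
      (by simp only [flipBlock_zero, flipBlock_one, flipBlock_two, flipBlock_three]; linarith)
      (by simp only [flipBlock_zero, flipBlock_one, flipBlock_two, flipBlock_three]; linarith)
      (by simp only [flipBlock_zero, flipBlock_one, flipBlock_two, flipBlock_three]; linarith)
    simp only [NormNonneg, flipBlock_zero, flipBlock_one, flipBlock_two, flipBlock_three] at *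
    linarith

end IsChamber
section Concrete

/-- The Gram matrix of `U ⊕ D₄ ⊕ D₄ ⊕ A₁⁴`, written out. -/
def explicitGram : Matrix (Fin 14) (Fin 14) ℤ :=
  !![0, 1, 0, 0, 0, 0, 0, 0, 0, 0, 0, 0, 0, 0;
      1, 0, 0, 0, 0, 0, 0, 0, 0, 0, 0, 0, 0, 0;
      0, 0, -2, 0, 1, 0, 0, 0, 0, 0, 0, 0, 0, 0;
      0, 0, 0, -2, 1, 0, 0, 0, 0, 0, 0, 0, 0, 0;
      0, 0, 1, 1, -2, 1, 0, 0, 0, 0, 0, 0, 0, 0;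
      0, 0, 0, 0, 1, -2, 0, 0, 0, 0, 0, 0, 0, 0;
      0, 0, 0, 0, 0, 0, -2, 0, 1, 0, 0, 0, 0, 0;
      0, 0, 0, 0, 0, 0, 0, -2, 1, 0, 0, 0, 0, 0;
      0, 0, 0, 0, 0, 0, 1, 1, -2, 1, 0, 0, 0, 0;
      0, 0, 0, 0, 0, 0, 0, 0, 1, -2, 0, 0, 0, 0;
      0, 0, 0, 0, 0, 0, 0, 0, 0, 0, -2, 0, 0, 0;
      0, 0, 0, 0, 0, 0, 0, 0, 0, 0, 0, -2, 0, 0;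
      0, 0, 0, 0, 0, 0, 0, 0, 0, 0, 0, 0, -2, 0;
      0, 0, 0, 0, 0, 0, 0, 0, 0, 0, 0, 0, 0, -2]

lemma gramS_eq : gramS = explicitGram := by
  decide +kernel

/-- The rows are the coordinate functionals `μ`, `ν`, `ω₀, …, ω₁₁`. -/
def frameMatrix : Matrix (Fin 14) (Fin 14) ℤ :=
  !![5, 6, -5, 1, 1, 1, -5, 1, 1, 1, -4, -4, -4, -4;
      2, 3, -2, 0, 1, 0, -2, 0, 1, 0, -2, -2, -2, -2;
      2, 3, -2, 0, 0, 2, -2, 0, 1, 0, -2, -2, -2, -2;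
      2, 3, -2, 0, 0, 0, -2, 0, 1, 0, -2, -2, -2, -2;
      2, 3, -2, 2, 0, 0, -2, 0, 1, 0, -2, -2, -2, -2;
      0, 1, 0, 0, 0, 0, -2, 0, 1, 0, 0, 0, 0, 0;
      2, 3, -2, 0, 1, 0, -2, 0, 0, 2, -2, -2, -2, -2;
      2, 3, -2, 0, 1, 0, -2, 0, 0, 0, -2, -2, -2, -2;
      2, 3, -2, 0, 1, 0, -2, 2, 0, 0, -2, -2, -2, -2;
      0, 1, -2, 0, 1, 0, 0, 0, 0, 0, 0, 0, 0, 0;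
      2, 2, -2, 0, 1, 0, -2, 0, 1, 0, 0, -2, -2, -2;
      2, 2, -2, 0, 1, 0, -2, 0, 1, 0, -2, 0, -2, -2;
      2, 2, -2, 0, 1, 0, -2, 0, 1, 0, -2, -2, 0, -2;
      2, 2, -2, 0, 1, 0, -2, 0, 1, 0, -2, -2, -2, 0]

/-- Twice the inverse of `frameMatrix`. -/
def frameInverse : Matrix (Fin 14) (Fin 14) ℤ :=
  !![6, 12, -3, -3, -3, -1, -3, -3, -3, -1, -2, -2, -2, -2;
      4, 10, -2, -2, -2, 0, -2, -2, -2, 0, -2, -2, -2, -2;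
      2, 6, -1, -2, -1, 0, -1, -1, -1, -1, -1, -1, -1, -1;
      0, 0, 0, -1, 1, 0, 0, 0, 0, 0, 0, 0, 0, 0;
      0, 2, 0, -2, 0, 0, 0, 0, 0, 0, 0, 0, 0, 0;
      0, 0, 1, -1, 0, 0, 0, 0, 0, 0, 0, 0, 0, 0;
      2, 6, -1, -1, -1, -1, -1, -2, -1, 0, -1, -1, -1, -1;
      0, 0, 0, 0, 0, 0, 0, -1, 1, 0, 0, 0, 0, 0;
      0, 2, 0, 0, 0, 0, 0, -2, 0, 0, 0, 0, 0, 0;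
      0, 0, 0, 0, 0, 0, 1, -1, 0, 0, 0, 0, 0, 0;
      2, 4, -1, -1, -1, 0, -1, -1, -1, 0, 0, -1, -1, -1;
      2, 4, -1, -1, -1, 0, -1, -1, -1, 0, -1, 0, -1, -1;
      2, 4, -1, -1, -1, 0, -1, -1, -1, 0, -1, -1, 0, -1;
      2, 4, -1, -1, -1, 0, -1, -1, -1, 0, -1, -1, -1, 0]

/-- Twice the Gram matrix in the coordinates `μ`, `ν`, `ω`. -/
def frameGram : Matrix (Fin 14) (Fin 14) ℤ :=
  of fun i j =>
    if i = 0 ∧ j = 1 ∨ i = 1 ∧ j = 0 then 2 else if i = j ∧ 2 ≤ i then -1 else 0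

/-- The simple roots. -/
def simpleRoot : Matrix (Fin 24) (Fin 14) ℤ :=
  !![0, 0, 0, 0, 0, 1, 0, 0, 0, 0, 0, 0, 0, 0;
      0, 0, -1, -1, -2, -2, 0, 0, 0, 0, 0, 0, 0, 0;
      0, 0, 1, 2, 2, 1, 0, 0, 0, 0, 0, 0, 0, 0;
      2, 2, 1, -1, 0, 0, 0, 0, 0, 0, 1, 1, 1, 1;
      1, 0, 0, 0, 0, 0, 1, 0, 0, 0, 0, 0, 0, 0;
      0, 0, 0, 0, 0, 0, 0, 0, 0, 1, 0, 0, 0, 0;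
      0, 0, 0, 0, 0, 0, -1, -1, -2, -2, 0, 0, 0, 0;
      0, 0, 0, 0, 0, 0, 1, 2, 2, 1, 0, 0, 0, 0;
      2, 2, 0, 0, 0, 0, 1, -1, 0, 0, 1, 1, 1, 1;
      1, 0, 1, 0, 0, 0, 0, 0, 0, 0, 0, 0, 0, 0;
      1, 0, 0, 0, 0, 0, 0, 0, 0, 0, 1, 0, 0, 0;
      0, 0, 0, 0, 0, 0, 0, 0, 0, 0, -1, 1, 0, 0;
      0, 0, 0, 0, 0, 0, 0, 0, 0, 0, 0, -1, 1, 0;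
      0, 0, 0, 0, 0, 0, 0, 0, 0, 0, 0, 0, -1, 1;
      2, 2, 1, 0, 0, 0, 1, 0, 0, 0, 1, 1, 1, 0;
      3, 3, 2, 0, 1, 0, 2, 0, 1, 0, 1, 1, 1, 1;
      -1, 1, 0, 0, 0, 0, 0, 0, 0, 0, 0, 0, 0, 0;
      0, 0, 0, 0, 0, 0, 0, 0, 1, 0, 0, 0, 0, 0;
      0, 0, 0, 0, 1, 0, 0, 0, 0, 0, 0, 0, 0, 0;
      2, 2, 1, -1, 0, 0, 1, -1, 0, 0, 1, 1, 0, 0;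
      0, 0, 0, 0, 0, 0, 0, 0, 0, 0, 0, 0, 0, -1;
      4, 4, 3, 0, 2, 1, 2, 0, 0, 0, 2, 1, 1, 1;
      4, 4, 2, 0, 0, 0, 3, 0, 2, 1, 2, 1, 1, 1;
      6, 4, 3, 0, 2, 1, 3, 0, 2, 1, 2, 2, 2, 1]

/-- Twice the functionals `⟨·, α⟩`, for `α` a simple root, in the coordinates `μ`, `ν`, `ω`. -/
def wallMatrix : Matrix (Fin 24) (Fin 14) ℤ :=
  !![0, 2, -2, 0, 0, 0, 0, 0, 0, 0, 0, 0, 0, 0;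
      0, 0, 2, -2, 0, 0, 0, 0, 0, 0, 0, 0, 0, 0;
      0, 0, 0, 2, -2, 0, 0, 0, 0, 0, 0, 0, 0, 0;
      0, 0, 0, 0, 2, -2, 0, 0, 0, 0, 0, 0, 0, 0;
      0, 0, 0, 0, 0, 2, 0, 0, 0, 0, 0, 0, 0, 0;
      0, 2, 0, 0, 0, 0, -2, 0, 0, 0, 0, 0, 0, 0;
      0, 0, 0, 0, 0, 0, 2, -2, 0, 0, 0, 0, 0, 0;
      0, 0, 0, 0, 0, 0, 0, 2, -2, 0, 0, 0, 0, 0;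
      0, 0, 0, 0, 0, 0, 0, 0, 2, -2, 0, 0, 0, 0;
      0, 0, 0, 0, 0, 0, 0, 0, 0, 2, 0, 0, 0, 0;
      0, 2, 0, 0, 0, 0, 0, 0, 0, 0, -2, 0, 0, 0;
      0, 0, 0, 0, 0, 0, 0, 0, 0, 0, 2, -2, 0, 0;
      0, 0, 0, 0, 0, 0, 0, 0, 0, 0, 0, 2, -2, 0;
      0, 0, 0, 0, 0, 0, 0, 0, 0, 0, 0, 0, 2, -2;
      0, 0, 0, 0, 0, 0, 0, 0, 0, 0, 0, 0, 0, 2;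
      2, -2, 0, 0, 0, 0, 0, 0, 0, 0, 0, 0, 0, 0;
      2, 2, -1, -1, -1, -1, -1, -1, -1, -1, 0, 0, 0, 0;
      2, 2, -1, -1, -1, -1, 0, 0, 0, 0, -1, -1, -1, -1;
      2, 2, 0, 0, 0, 0, -1, -1, -1, -1, -1, -1, -1, -1;
      4, 4, -2, -2, 0, 0, -2, -2, 0, 0, -2, -2, 0, 0;
      4, 8, -2, -2, -2, 0, -2, -2, -2, 0, -2, -2, -2, 0;
      4, 4, -2, 0, 0, 0, -2, -2, -2, 0, -2, 0, 0, 0;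
      4, 4, -2, -2, -2, 0, -2, 0, 0, 0, -2, 0, 0, 0;
      4, 4, -2, 0, 0, 0, -2, 0, 0, 0, -2, -2, -2, 0]

/-- A vector in the interior of the chamber. -/
def interiorPoint : Fin 14 → ℤ := ![21, 17, 10, -1, 4, 1, 10, -1, 4, 1, 8, 7, 6, 5]

lemma frameMatrix_gram : frameMatrixᵀ * frameGram * frameMatrix = 2 • explicitGram := by
  decide +kernel

lemma frameInverse_mul : frameInverse * frameMatrix = 2 • (1 : Matrix (Fin 14) (Fin 14) ℤ) := by
  decide +kernel

lemma wallMatrix_mul : wallMatrix * frameMatrix = 2 • (simpleRoot * explicitGram) := by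
  decide +kernel

lemma dotProduct_frameGram (x y : Fin 14 → ℤ) :
    x ⬝ᵥ frameGram *ᵥ y = 2 * (x 0 * y 1 + x 1 * y 0) -
      (fun i : Fin 12 => x (Fin.natAdd 2 i)) ⬝ᵥ (fun i : Fin 12 => y (Fin.natAdd 2 i)) := by
  simp [dotProduct, mulVec, Fin.sum_univ_succ, frameGram]
  ring

/-- The coordinates `μ`, `ν`, `ω` on `U ⊕ D₄ ⊕ D₄ ⊕ A₁⁴`. -/
def frame : LorentzFrame explicitGram 12 where
  μ := LinearMap.proj 0 ∘ₗ frameMatrix.mulVecLin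
  ν := LinearMap.proj 1 ∘ₗ frameMatrix.mulVecLin
  ω := LinearMap.funLeft ℤ ℤ (Fin.natAdd 2) ∘ₗ frameMatrix.mulVecLin
  form x y := by
    have h := dotProduct_frameGram (frameMatrix *ᵥ x) (frameMatrix *ᵥ y)
    have e : (frameMatrix *ᵥ x) ⬝ᵥ frameGram *ᵥ frameMatrix *ᵥ y = 2 * bform explicitGram x y := by
      rw [bform, ← vecMul_transpose, ← dotProduct_mulVec, mulVec_mulVec, mulVec_mulVec,
        frameMatrix_gram, smul_mulVec, dotProduct_smul, nsmul_eq_mul]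
      rfl
    rw [← e, h]
    rfl
  eq_zero x h0 h1 hω := by
    have hx : frameMatrix *ᵥ x = 0 := by
      ext i
      induction i using Fin.addCases (m := 2) (n := 12) with
      | left i => fin_cases i; exacts [h0, h1]
      | right i => exact congrFun hω i
    have h2 : frameInverse *ᵥ frameMatrix *ᵥ x = 2 • x := by
      rw [mulVec_mulVec, frameInverse_mul, smul_mulVec, one_mulVec]
    rw [hx, mulVec_zero] at h2
    exact (smul_eq_zero.mp h2.symm).resolve_left two_ne_zero

lemma two_mul_bform_simpleRoot (x : Fin 14 → ℤ) (i : Fin 24) :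
    2 * bform explicitGram x (simpleRoot i) = (wallMatrix *ᵥ frameMatrix *ᵥ x) i := by
  rw [mulVec_mulVec, wallMatrix_mul, frame.bform_comm, bform,
    smul_mulVec, ← mulVec_mulVec]
  simp only [Pi.smul_apply, nsmul_eq_mul, Nat.cast_ofNat]
  rfl

lemma isRoot_of_dvd {n : ℕ} {G : Matrix (Fin n) (Fin n) ℤ} {α : Fin n → ℤ}
    (h : bform G α α = -2 ∨ (bform G α α = -4 ∧ ∀ j, 2 ∣ (α ᵥ* G) j)) : IsRoot G α := by
  refine h.imp_right fun h => ⟨h.1, fun x => ?_⟩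
  rw [bform, dotProduct_mulVec]
  exact Finset.dvd_sum fun j _ => (h.2 j).mul_right _

lemma isRoot_simpleRoot (i : Fin 24) : IsRoot explicitGram (simpleRoot i) := by
  refine isRoot_of_dvd ?_
  revert i
  unfold bform
  decide +kernel

lemma isChamber_of_wallMatrix {y : Fin 14 → ℤ} (h : ∀ i, 0 ≤ (wallMatrix *ᵥ y) i) :
    IsChamber (2 * y 0) (y 1) ![y 2, y 3, y 4, y 5] ![y 6, y 7, y 8, y 9]
      ![y 10, y 11, y 12, y 13] := by
  simp [Fin.forall_fin_succ, wallMatrix, mulVec, dotProduct, Fin.sum_univ_succ] at h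
  constructor
  all_goals first
    | linarith
    | (constructor <;> simp <;> linarith)
    | (simp; linarith)

lemma bform_nonneg_of_simpleRoot {x : Fin 14 → ℤ}
    (hx : ∀ i, 0 ≤ bform explicitGram x (simpleRoot i)) : 0 ≤ bform explicitGram x x := by
  have h := (isChamber_of_wallMatrix (y := frameMatrix *ᵥ x) fun i => by
    rw [← two_mul_bform_simpleRoot]
    linarith [hx i]).normNonneg
  have hform := frame.form x x
  simp [frame, dotProduct, Fin.sum_univ_succ, LinearMap.funLeft] at hform
  simp [NormNonneg] at h
  linarith

end Concrete

/-- The lattice `U ⊕ D₄ ⊕ D₄ ⊕ A₁⁴` is reflective: the subgroup `W_r` of `O(S)`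
generated by the reflections in all roots has finite index in `O(S)`. -/
theorem reflective_14_8_1 : (Wr _ gramS).FiniteIndex := by
  rw [gramS_eq]
  exact frame.finiteIndex_Wr isRoot_simpleRoot (ρ := interiorPoint)
    (by unfold bform; decide +kernel) (by decide +kernel)
    (by unfold bform; decide +kernel) fun x => bform_nonneg_of_simpleRoot
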